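/- arXiv:2201.00362 — 6 statements merged into one kernel-verified Lean document; each statement's English description precedes it below -/
import Mathlib

section
/- Let a < b be real numbers and let u : ℝ → ℝ be continuously differentiable. Let μ_u be the occupation measure of u on (a,b), and let φ : ℝ × ℝ → ℝ be continuously differentiable. Then ∫ (∂φ/∂x (x,y) + z · ∂φ/∂y (x,y)) dμ_u(x,y,z) = φ(b, u(b)) − φ(a, u(a)). (This is the one-dimensional instance of the divergence-theorem identity ⟨𝒟φ, μ_u⟩ = ⟨φ·n̂, ν_u⟩ relating occupation and boundary measures, where the boundary measure ν_u = δ_{(a,u(a))} + δ_{(b,u(b))} and the outward normal is −1 at a and +1 at b.) -/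
open MeasureTheory

/-- One-dimensional divergence-theorem identity for the occupation measure `μ_u`
of a continuously differentiable function `u` on `(a, b)`:
`∫ (∂φ/∂x (x,y) + z ⬝ ∂φ/∂y (x,y)) dμ_u(x,y,z) = φ(b, u(b)) − φ(a, u(a))`. -/
theorem occupation_measure_divergence_1d
    (a b : ℝ) (hab : a < b) (u : ℝ → ℝ) (hu : ContDiff ℝ 1 u)
    (φ : ℝ × ℝ → ℝ) (hφ : ContDiff ℝ 1 φ)
    (μ : Measure (ℝ × ℝ × ℝ))
    (hμ : μ = Measure.map (fun x => (x, u x, deriv u x)) (volume.restrict (Set.Ioo a b))) :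
    (∫ p : ℝ × ℝ × ℝ,
        (fderiv ℝ φ (p.1, p.2.1) (1, 0) + p.2.2 * fderiv ℝ φ (p.1, p.2.1) (0, 1)) ∂μ)
      = φ (b, u b) - φ (a, u a) := by
  have hu' : Continuous (deriv u) := hu.continuous_deriv le_rfl
  have hφ' : Continuous (fderiv ℝ φ) := hφ.continuous_fderiv one_ne_zero
  have hcu : Continuous u := hu.continuous
  have hF : Continuous fun p : ℝ × ℝ × ℝ =>
      fderiv ℝ φ (p.1, p.2.1) (1, 0) + p.2.2 * fderiv ℝ φ (p.1, p.2.1) (0, 1) := by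
    fun_prop
  have hg : Continuous fun x => (x, u x, deriv u x) := by fun_prop
  have hderiv (x : ℝ) : HasDerivAt (fun t => φ (t, u t))
      (fderiv ℝ φ (x, u x) (1, 0) + deriv u x * fderiv ℝ φ (x, u x) (0, 1)) x := by
    have hgraph : HasDerivAt (fun t => (t, u t)) ((1 : ℝ), deriv u x) x :=
      (hasDerivAt_id x).prodMk (hu.differentiable one_ne_zero x).hasDerivAt
    have hchain := (hφ.differentiable one_ne_zero (x, u x)).hasFDerivAt.comp_hasDerivAt x hgraph
    have hsplit : ((1 : ℝ), deriv u x) = (1, 0) + deriv u x • ((0 : ℝ), (1 : ℝ)) := by simp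
    rw [hsplit, map_add, map_smul, smul_eq_mul] at hchain
    exact hchain
  rw [hμ, integral_map hg.aemeasurable hF.aestronglyMeasurable,
    ← integral_Ioc_eq_integral_Ioo, ← intervalIntegral.integral_of_le hab.le]
  exact intervalIntegral.integral_eq_sub_of_hasDerivAt (fun x _ => hderiv x)
    ((hF.comp hg).intervalIntegrable a b)
end

section
/- Let A ∈ O(n) and B ∈ O(m) be orthogonal matrices, and let φ : ℝⁿ × ℝᵐ → ℝⁿ be continuously differentiable. Define φ_{A,B}(x,y) := Aᵀ φ(Ax, By). Then for all x ∈ ℝⁿ, y ∈ ℝᵐ and Z ∈ ℝ^{m×n}, the total divergence satisfies 𝒟φ_{A,B}(x,y,Z) = 𝒟φ(Ax, By, B Z Aᵀ), i.e. 𝒟φ_{A,B} = 𝒟φ ∘ G_{A,B}. -/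
open scoped BigOperators

/-- The total divergence `𝒟φ(x,y,Z) = Σᵢ [∂φᵢ/∂xᵢ (x,y) + Σⱼ Z_{ji} ∂φᵢ/∂yⱼ (x,y)]`
of `φ : ℝⁿ × ℝᵐ → ℝⁿ`. -/
noncomputable def totalDiv {n m : ℕ} (φ : (Fin n → ℝ) × (Fin m → ℝ) → Fin n → ℝ)
    (x : Fin n → ℝ) (y : Fin m → ℝ) (Z : Matrix (Fin m) (Fin n) ℝ) : ℝ :=
  ∑ i, (fderiv ℝ φ (x, y) (Pi.single i 1, 0) i
    + ∑ j, Z j i * fderiv ℝ φ (x, y) (0, Pi.single j 1) i)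

/-- The total divergence is the trace of `v ↦ Dφ(x,y)(v, Zv)`. -/
theorem totalDiv_eq_trace {n m : ℕ} (φ : (Fin n → ℝ) × (Fin m → ℝ) → Fin n → ℝ)
    (x : Fin n → ℝ) (y : Fin m → ℝ) (Z : Matrix (Fin m) (Fin n) ℝ) :
    totalDiv φ x y Z = LinearMap.trace ℝ (Fin n → ℝ)
      ((fderiv ℝ φ (x, y)).toLinearMap ∘ₗ LinearMap.id.prod Z.mulVecLin) := by
  rw [LinearMap.trace_eq_matrix_trace ℝ (Pi.basisFun ℝ (Fin n)), totalDiv, Matrix.trace]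
  refine Finset.sum_congr rfl fun i _ => ?_
  have hcol : ((Pi.single i 1, Z.col i) : (Fin n → ℝ) × (Fin m → ℝ))
      = (Pi.single i 1, 0) + ∑ j, Z j i • ((0, Pi.single j 1) : (Fin n → ℝ) × (Fin m → ℝ)) := by
    ext k
    · simp [Prod.fst_sum]
    · simp [Prod.snd_sum, Finset.sum_apply, Pi.single_apply]
  simp only [Matrix.diag_apply, LinearMap.toMatrix_apply, Pi.basisFun_apply, Pi.basisFun_repr,
    LinearMap.comp_apply, LinearMap.prod_apply, Function.prod, LinearMap.id_apply,
    Matrix.mulVecLin_apply, Matrix.mulVec_single_one, ContinuousLinearMap.coe_coe]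
  rw [hcol]
  simp only [map_add, map_sum, map_smul, Pi.add_apply, Finset.sum_apply, Pi.smul_apply, smul_eq_mul]

/-- For orthogonal matrices `A ∈ O(n)`, `B ∈ O(m)` and continuously differentiable
`φ : ℝⁿ × ℝᵐ → ℝⁿ`, the function `φ_{A,B}(x,y) := Aᵀ φ(Ax, By)` satisfies
`𝒟φ_{A,B}(x,y,Z) = 𝒟φ(Ax, By, B Z Aᵀ)`, i.e. `𝒟φ_{A,B} = 𝒟φ ∘ G_{A,B}`. -/
theorem totalDiv_comp_orthogonal {n m : ℕ}
    (A : Matrix (Fin n) (Fin n) ℝ) (B : Matrix (Fin m) (Fin m) ℝ)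
    (hA : A ∈ Matrix.orthogonalGroup (Fin n) ℝ) (hB : B ∈ Matrix.orthogonalGroup (Fin m) ℝ)
    (φ : (Fin n → ℝ) × (Fin m → ℝ) → Fin n → ℝ) (hφ : ContDiff ℝ 1 φ) :
    ∀ (x : Fin n → ℝ) (y : Fin m → ℝ) (Z : Matrix (Fin m) (Fin n) ℝ),
      totalDiv (fun p => A.transpose.mulVec (φ (A.mulVec p.1, B.mulVec p.2))) x y Z
        = totalDiv φ (A.mulVec x) (B.mulVec y) (B * Z * A.transpose) := by
  intro x y Z
  have hAA : A.transpose * A = 1 := (Matrix.mem_orthogonalGroup_iff' _ _).1 hA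
  have hAA' : A * A.transpose = 1 := mul_eq_one_comm.mp hAA
  let G : (Fin n → ℝ) × (Fin m → ℝ) →L[ℝ] (Fin n → ℝ) × (Fin m → ℝ) :=
    (A.mulVecLin.toContinuousLinearMap).prodMap B.mulVecLin.toContinuousLinearMap
  have hderiv := (A.transpose.mulVecLin.toContinuousLinearMap.hasFDerivAt).comp (x, y)
    (((hφ.differentiable one_ne_zero (G (x, y))).hasFDerivAt).comp (x, y) G.hasFDerivAt)
  have hfderiv : fderiv ℝ (fun p : (Fin n → ℝ) × (Fin m → ℝ) =>
      A.transpose.mulVec (φ (A.mulVec p.1, B.mulVec p.2))) (x, y) = _ := hderiv.fderiv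
  rw [totalDiv_eq_trace, totalDiv_eq_trace, hfderiv]
  set T := (fderiv ℝ φ (A.mulVec x, B.mulVec y)).toLinearMap ∘ₗ
    LinearMap.id.prod (B * Z * A.transpose).mulVecLin with hT
  have hconj : T = (T ∘ₗ A.mulVecLin) ∘ₗ A.transpose.mulVecLin := by
    rw [LinearMap.comp_assoc, ← Matrix.mulVecLin_mul, hAA', Matrix.mulVecLin_one,
      LinearMap.comp_id]
  rw [hconj, LinearMap.trace_comp_comm' A.transpose.mulVecLin (T ∘ₗ A.mulVecLin)]
  apply congrArg (LinearMap.trace ℝ (Fin n → ℝ))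
  refine LinearMap.ext fun v => ?_
  have hZ : (B * Z * A.transpose).mulVec (A.mulVec v) = B.mulVec (Z.mulVec v) := by
    rw [Matrix.mulVec_mulVec, Matrix.mul_assoc, hAA, Matrix.mul_one, Matrix.mulVec_mulVec]
  simp only [hT, LinearMap.comp_apply, LinearMap.prod_apply, Function.prod, Matrix.mulVecLin_apply,
    LinearMap.id_apply, hZ]
  rfl
end

section
/- Let P be a real symmetric positive semidefinite n×n matrix and let Q be a real symmetric positive semidefinite matrix of size mn × mn, with rows and columns indexed by pairs (i,j) ∈ {1,…,m} × {1,…,n}, partitioned into m² blocks Q_{i i'} of size n×n with entries (Q_{i i'})_{j j'} = Q_{(i,j),(i',j')}. Then the m×m matrix 𝒯(P,Q) with entries 𝒯(P,Q)_{i i'} = trace(P Q_{i i'}) is symmetric positive semidefinite. -/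
/-- Contracting the second tensor factor of a positive semidefinite matrix against a Gram matrix
`Bᵀ B` gives a positive semidefinite matrix. -/
theorem Matrix.PosSemidef.trace_gram_mul_block {ι κ τ : Type*} [Fintype ι] [Fintype κ] [Fintype τ]
    {Q : Matrix (ι × κ) (ι × κ) ℝ} (hQ : Q.PosSemidef) (B : Matrix τ κ ℝ) :
    (Matrix.of fun i i' : ι =>
      (B.transpose * B * Matrix.of fun j j' : κ => Q (i, j) (i', j')).trace).PosSemidef := by
  classical
  let C : τ → Matrix (ι × κ) ι ℝ := fun k => Matrix.of fun p i => if p.1 = i then B k p.2 else 0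
  have hsum := Matrix.posSemidef_sum Finset.univ
    fun k _ => hQ.conjTranspose_mul_mul_same (C k)
  convert hsum using 1
  ext i i'
  have hC : ∀ k, ((C k).conjTranspose * Q * C k) i i' =
      ∑ j, ∑ j', B k j' * Q (i, j') (i', j) * B k j := by
    intro k
    simp [C, Matrix.mul_apply, Fintype.sum_prod_type_right, Finset.sum_mul]
  simp only [Matrix.sum_apply, hC, Matrix.of_apply, Matrix.trace, Matrix.diag_apply,
    Matrix.mul_apply, Matrix.transpose_apply, Finset.sum_mul]
  rw [Finset.sum_comm_cycle]
  refine Finset.sum_congr rfl fun k _ => Finset.sum_congr rfl fun j _ =>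
    Finset.sum_congr rfl fun j' _ => ?_
  ring

/-- If `P ∈ 𝕊ⁿ` and `Q ∈ 𝕊^{mn}` (indexed by pairs `(i,j)` and partitioned into
`n × n` blocks `Q_{ii'}` with `(Q_{ii'})_{jj'} = Q_{(i,j),(i',j')}`) are positive
semidefinite, then the `m × m` matrix `𝒯(P,Q)` with entries
`𝒯(P,Q)_{ii'} = trace(P Q_{ii'})` is positive semidefinite. -/
theorem trace_contraction_posSemidef {n m : ℕ}
    (P : Matrix (Fin n) (Fin n) ℝ) (Q : Matrix (Fin m × Fin n) (Fin m × Fin n) ℝ)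
    (hP : P.PosSemidef) (hQ : Q.PosSemidef) :
    (Matrix.of fun i i' : Fin m =>
      (P * Matrix.of fun j j' : Fin n => Q (i, j) (i', j')).trace).PosSemidef := by
  open scoped MatrixOrder in
  obtain ⟨B, rfl⟩ := CStarAlgebra.nonneg_iff_eq_star_mul_self.mp hP.nonneg
  simpa [Matrix.star_eq_conjTranspose] using hQ.trace_gram_mul_block B
end

section
/- (Jensen–Poincaré inequality, sufficiency.) Let u : ℝ → ℝ be continuously differentiable with u(−1) = u(1) = 0. Then for every real λ ≥ 2/3, λ ∫_{−1}^{1} u'(x)² dx − ( ∫_{−1}^{1} u(x) dx )² ≥ 0. -/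
open MeasureTheory

/-- Cauchy–Schwarz against the weight `x` on `[-1, 1]`. -/
lemma sq_integral_id_mul_le {f : ℝ → ℝ} (hf : Continuous f) :
    (∫ x in (-1 : ℝ)..1, x * f x) ^ 2 ≤ 2 / 3 * ∫ x in (-1 : ℝ)..1, f x ^ 2 := by
  have hexpand (c : ℝ) : ∫ x in (-1 : ℝ)..1, (f x - c * x) ^ 2 =
      (∫ x in (-1 : ℝ)..1, f x ^ 2) - 2 * c * (∫ x in (-1 : ℝ)..1, x * f x) +
        c ^ 2 * (2 / 3) := by
    have hsq : ∫ x in (-1 : ℝ)..1, x ^ 2 = 2 / 3 := by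
      rw [integral_pow]; norm_num
    rw [← hsq, ← intervalIntegral.integral_const_mul (2 * c),
      ← intervalIntegral.integral_const_mul (c ^ 2),
      ← intervalIntegral.integral_sub, ← intervalIntegral.integral_add]
    · congr 1
      ext x
      ring
    all_goals exact Continuous.intervalIntegrable (by fun_prop) _ _
  have hnonneg (c : ℝ) : 0 ≤ ∫ x in (-1 : ℝ)..1, (f x - c * x) ^ 2 :=
    intervalIntegral.integral_nonneg (by norm_num) fun x _ => sq_nonneg _
  have h := hnonneg (3 / 2 * ∫ x in (-1 : ℝ)..1, x * f x)
  rw [hexpand] at h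
  linarith

/-- Integration by parts against `x` for a function vanishing at both ends of `[-1, 1]`. -/
lemma integral_eq_neg_integral_id_mul_deriv {u : ℝ → ℝ} (hu : ContDiff ℝ 1 u)
    (hm1 : u (-1) = 0) (hp1 : u 1 = 0) :
    ∫ x in (-1 : ℝ)..1, u x = -∫ x in (-1 : ℝ)..1, x * deriv u x := by
  have hparts := intervalIntegral.integral_mul_deriv_eq_deriv_mul (a := -1) (b := 1)
    (u := fun x : ℝ => x) (u' := fun _ => 1) (v := u) (v' := deriv u)
    (fun x _ => hasDerivAt_id x)
    (fun x _ => (hu.differentiable one_ne_zero x).hasDerivAt)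
    (continuous_const.intervalIntegrable _ _)
    (hu.continuous_deriv_one.intervalIntegrable _ _)
  simp [hm1, hp1] at hparts
  linarith

/-- Jensen–Poincaré inequality, sufficiency: for `u ∈ C¹` with `u(±1) = 0` and any
`λ ≥ 2/3`, one has `λ ∫_{−1}^{1} u'(x)² dx − (∫_{−1}^{1} u(x) dx)² ≥ 0`. -/
theorem jensen_poincare_sufficiency (u : ℝ → ℝ) (hu : ContDiff ℝ 1 u)
    (hm1 : u (-1) = 0) (hp1 : u 1 = 0) (lam : ℝ) (hlam : 2 / 3 ≤ lam) :
    0 ≤ lam * (∫ x in Set.Ioo (-1 : ℝ) 1, (deriv u x) ^ 2)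
        - (∫ x in Set.Ioo (-1 : ℝ) 1, u x) ^ 2 := by
  simp only [← integral_Ioc_eq_integral_Ioo,
    ← intervalIntegral.integral_of_le (show (-1 : ℝ) ≤ 1 by norm_num)]
  have hcs := sq_integral_id_mul_le hu.continuous_deriv_one
  have hnonneg : 0 ≤ ∫ x in (-1 : ℝ)..1, deriv u x ^ 2 :=
    intervalIntegral.integral_nonneg (by norm_num) fun x _ => sq_nonneg _
  rw [integral_eq_neg_integral_id_mul_deriv hu hm1 hp1, neg_sq]
  linarith [mul_le_mul_of_nonneg_right hlam hnonneg]
end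

section
/- (Jensen–Poincaré inequality, sharpness of λ = 2/3.) For every real λ < 2/3 there exists a continuously differentiable function u : ℝ → ℝ with u(−1) = u(1) = 0 such that λ ∫_{−1}^{1} u'(x)² dx − ( ∫_{−1}^{1} u(x) dx )² < 0. (A witness is u(x) = 1 − x², for which ∫_{−1}^{1} u dx = 4/3 and ∫_{−1}^{1} u'² dx = 8/3, so that ( ∫ u )² = (2/3) ∫ u'².) -/
open MeasureTheory

/-- Jensen–Poincaré inequality, sharpness of `λ = 2/3`: for every `λ < 2/3` there exists
a `C¹` function `u` with `u(±1) = 0` such that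
`λ ∫_{−1}^{1} u'(x)² dx − (∫_{−1}^{1} u(x) dx)² < 0`. -/
theorem jensen_poincare_sharpness (lam : ℝ) (hlam : lam < 2 / 3) :
    ∃ u : ℝ → ℝ, ContDiff ℝ 1 u ∧ u (-1) = 0 ∧ u 1 = 0 ∧
      lam * (∫ x in Set.Ioo (-1 : ℝ) 1, (deriv u x) ^ 2)
        - (∫ x in Set.Ioo (-1 : ℝ) 1, u x) ^ 2 < 0 := by
  have hderiv (x : ℝ) : deriv (fun x : ℝ => 1 - x ^ 2) x = -(2 * x) := by
    simp
  have hle : (-1 : ℝ) ≤ 1 := by norm_num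
  refine ⟨fun x => 1 - x ^ 2, by fun_prop, by norm_num, by norm_num, ?_⟩
  have hint : ∫ x in Set.Ioo (-1 : ℝ) 1, (1 - x ^ 2) = 4 / 3 := by
    rw [← integral_Ioc_eq_integral_Ioo, ← intervalIntegral.integral_of_le hle,
      intervalIntegral.integral_sub (by simp) (by simp), integral_pow]
    norm_num
  have hint_deriv : ∫ x in Set.Ioo (-1 : ℝ) 1, (-(2 * x)) ^ 2 = 8 / 3 := by
    rw [← integral_Ioc_eq_integral_Ioo, ← intervalIntegral.integral_of_le hle]
    simp only [neg_sq, mul_pow]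
    rw [intervalIntegral.integral_const_mul, integral_pow]
    norm_num
  simp only [hderiv]
  rw [hint, hint_deriv]
  linarith
end

section
/- (SDP verification of the Jensen–Poincaré certificate.) Let ξ₀₁₀, ξ₁₁₁, ξ₂₀₂, ξ₀₀₂, ξ₂₁₀, ξ₂₂₀ be real numbers such that the two symmetric matrices M₁ = [[2, ξ₀₁₀, −ξ₀₁₀, 0, 0, 0], [ξ₀₁₀, −2ξ₁₁₁, ξ₁₁₁, 0, 0, 0], [−ξ₀₁₀, ξ₁₁₁, ξ₂₀₂, 0, 0, 0], [0, 0, 0, ξ₀₀₂, −ξ₀₁₀, ξ₁₁₁], [0, 0, 0, −ξ₀₁₀, 2/3, ξ₂₁₀], [0, 0, 0, ξ₁₁₁, ξ₂₁₀, ξ₂₂₀]] and M_g = [[4/3, ξ₀₁₀ − ξ₂₁₀, 0], [ξ₀₁₀ − ξ₂₁₀, −ξ₁₁₁ − ξ₂₂₀, 0], [0, 0, ξ₀₀₂ − ξ₂₀₂]] are both positive semidefinite. Then for every real λ ≥ 2/3, λ ξ₀₀₂ − ξ₀₁₀² ≥ 0. -/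
/-- SDP verification of the Jensen–Poincaré certificate: if the moment matrix `M₁` and
the localizing matrix `M_g` of the first-order moment relaxation are both positive
semidefinite, then `λ ξ₀₀₂ − ξ₀₁₀² ≥ 0` for every `λ ≥ 2/3`. -/
theorem jensen_poincare_sdp_certificate
    (ξ010 ξ111 ξ202 ξ002 ξ210 ξ220 : ℝ)
    (hM1 : (!![(2 : ℝ), ξ010, -ξ010, 0, 0, 0;
               ξ010, -2 * ξ111, ξ111, 0, 0, 0;
               -ξ010, ξ111, ξ202, 0, 0, 0;
               0, 0, 0, ξ002, -ξ010, ξ111;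
               0, 0, 0, -ξ010, 2 / 3, ξ210;
               0, 0, 0, ξ111, ξ210, ξ220]).PosSemidef)
    (hMg : (!![(4 : ℝ) / 3, ξ010 - ξ210, 0;
               ξ010 - ξ210, -ξ111 - ξ220, 0;
               0, 0, ξ002 - ξ202]).PosSemidef) :
    ∀ lam : ℝ, 2 / 3 ≤ lam → 0 ≤ lam * ξ002 - ξ010 ^ 2 := by
  intro lam hlam
  have h_diag : 0 ≤ ξ002 := hM1.diag_nonneg (i := 3)
  have h_minor := (hM1.submatrix ![3, 4]).det_nonneg
  rw [Matrix.det_fin_two] at h_minor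
  have h_det : 0 ≤ ξ002 * (2 / 3) - -ξ010 * -ξ010 := h_minor
  nlinarith [mul_le_mul_of_nonneg_right hlam h_diag]
end
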